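/- For every γ > 0 and every λ > 0: ∫ s/(s + λ)² dMP(γ)(s) ≥ (1 − √( λ² · ∫ 1/(s + λ)² dMP(γ)(s) ))². -/

import Mathlib

open MeasureTheory

/-- The Marchenko–Pastur measure with aspect ratio `γ`: a point mass of weight
`max 0 (1 - 1/γ)` at `0` plus the absolutely continuous part with density
`s ↦ √((b - s)(s - a)) / (2πγs)` on `[a, b]`, where `a = (1 - √γ)²`, `b = (1 + √γ)²`. -/
noncomputable def MP (γ : ℝ) : Measure ℝ :=
  ENNReal.ofReal (max 0 (1 - 1 / γ)) • Measure.dirac 0 +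
    volume.withDensity
      (Set.indicator (Set.Icc ((1 - Real.sqrt γ) ^ 2) ((1 + Real.sqrt γ) ^ 2))
        (fun s => ENNReal.ofReal
          (Real.sqrt (((1 + Real.sqrt γ) ^ 2 - s) * (s - (1 - Real.sqrt γ) ^ 2)) /
            (2 * Real.pi * γ * s))))

open Real Set

/-- On `(a, b)` the map `s ↦ arcsin ((s - c) / r)`, with `c` the midpoint and `r` the half-length,
is a primitive of `1 / √((b - s)(s - a))`. -/
lemma hasDerivAt_arcsin_affine {a b s : ℝ} (has : a < s) (hsb : s < b) :
    HasDerivAt (fun x => arcsin ((x - (a + b) / 2) / ((b - a) / 2)))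
      (1 / √((b - s) * (s - a))) s := by
  have hr : 0 < (b - a) / 2 := by linarith
  have hr' : b - a ≠ 0 := by linarith
  have hR : 0 < (b - s) * (s - a) := mul_pos (by linarith) (by linarith)
  have h1 : (s - (a + b) / 2) / ((b - a) / 2) ≠ -1 := by
    rw [Ne, div_eq_iff hr.ne']
    intro h
    linarith
  have h2 : (s - (a + b) / 2) / ((b - a) / 2) ≠ 1 := by
    rw [Ne, div_eq_iff hr.ne']
    intro h
    linarith
  have h3 : √(1 - ((s - (a + b) / 2) / ((b - a) / 2)) ^ 2) =
      √((b - s) * (s - a)) / ((b - a) / 2) := by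
    rw [← sqrt_sq hr.le, ← sqrt_div hR.le, sqrt_sq hr.le]
    congr 1
    field_simp
    ring
  have h := (hasDerivAt_arcsin h1 h2).comp s
    (((hasDerivAt_id s).sub_const ((a + b) / 2)).div_const ((b - a) / 2))
  refine h.congr_deriv ?_
  have := sqrt_pos.2 hR
  rw [h3]
  field_simp

lemma hasDerivAt_sqrt_mul_sub {a b s : ℝ} (has : a < s) (hsb : s < b) :
    HasDerivAt (fun x => √((b - x) * (x - a)))
      (((a + b) / 2 - s) / √((b - s) * (s - a))) s := by
  have hR : 0 < (b - s) * (s - a) := mul_pos (by linarith) (by linarith)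
  have h := (((hasDerivAt_id s).const_sub b).mul ((hasDerivAt_id s).sub_const a)).sqrt hR.ne'
  refine h.congr_deriv ?_
  have := sqrt_pos.2 hR
  simp only [id, Pi.mul_apply]
  field_simp
  ring

lemma hasDerivAt_arcsin_inv {a b s : ℝ} (ha : 0 < a) (has : a < s) (hsb : s < b) :
    HasDerivAt (fun x => arcsin (((a + b) / 2 - a * b / x) / ((b - a) / 2)))
      (√(a * b) / (s * √((b - s) * (s - a)))) s := by
  have hr : 0 < b - a := by linarith
  have hs : 0 < s := by linarith
  have hb : 0 < b := by linarith
  have hR : 0 < (b - s) * (s - a) := mul_pos (by linarith) (by linarith)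
  have h3 : 1 - (((a + b) / 2 - a * b / s) / ((b - a) / 2)) ^ 2 =
      (a * b) * ((b - s) * (s - a)) / ((b - a) / 2 * s) ^ 2 := by
    field_simp
    ring
  have hpos : 0 < 1 - (((a + b) / 2 - a * b / s) / ((b - a) / 2)) ^ 2 := by
    rw [h3]
    positivity
  have h1 : ((a + b) / 2 - a * b / s) / ((b - a) / 2) ≠ -1 := by
    intro h
    rw [h] at hpos
    norm_num at hpos
  have h2 : ((a + b) / 2 - a * b / s) / ((b - a) / 2) ≠ 1 := by
    intro h
    rw [h] at hpos
    norm_num at hpos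
  have h := (hasDerivAt_arcsin h1 h2).comp s
    ((((hasDerivAt_inv hs.ne').const_mul (a * b)).const_sub ((a + b) / 2)).div_const ((b - a) / 2))
  refine h.congr_deriv ?_
  have hR' := sqrt_pos.2 hR
  have hab : 0 < a * b := mul_pos ha hb
  have hab' := sqrt_pos.2 hab
  rw [h3, sqrt_div (by positivity), sqrt_sq (by positivity), sqrt_mul hab.le]
  field_simp
  rw [sq_sqrt hab.le]

/-- A function continuous on `[a, b]` with nonnegative derivative `f'` on `(a, b)` gives
integrability and the value of the integral of `f'`. -/
lemma integrableOn_and_integral_eq_of_hasDerivAt_nonneg {a b : ℝ} {f f' : ℝ → ℝ} (hab : a ≤ b)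
    (hcont : ContinuousOn f (Icc a b)) (hderiv : ∀ x ∈ Ioo a b, HasDerivAt f (f' x) x)
    (hpos : ∀ x ∈ Ioo a b, 0 ≤ f' x) :
    IntegrableOn f' (Icc a b) ∧ ∫ x in Icc a b, f' x = f b - f a := by
  have hint := intervalIntegral.integrableOn_deriv_of_nonneg hcont hderiv hpos
  refine ⟨(integrableOn_Icc_iff_integrableOn_Ioc (by simp)).2 hint, ?_⟩
  rw [integral_Icc_eq_integral_Ioc, ← intervalIntegral.integral_of_le hab]
  exact intervalIntegral.integral_eq_sub_of_hasDerivAt_of_le hab hcont hderiv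
    ((intervalIntegrable_iff_integrableOn_Ioc_of_le hab).2 hint)

/-- The area under the half-circle with diameter `[a, b]`. -/
lemma integral_sqrt_mul_sub {a b : ℝ} (hab : a < b) :
    IntegrableOn (fun s => √((b - s) * (s - a))) (Icc a b) ∧
      ∫ s in Icc a b, √((b - s) * (s - a)) = π * (b - a) ^ 2 / 8 := by
  have key := integrableOn_and_integral_eq_of_hasDerivAt_nonneg
    (f := fun x => ((x - (a + b) / 2) * √((b - x) * (x - a)) +
      ((b - a) / 2) ^ 2 * arcsin ((x - (a + b) / 2) / ((b - a) / 2))) / 2)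
    (f' := fun s => √((b - s) * (s - a))) hab.le ?_ ?_ (fun _ _ => sqrt_nonneg _)
  · refine ⟨key.1, key.2.trans ?_⟩
    have hr : b - a ≠ 0 := by linarith
    have e1 : (b - (a + b) / 2) / ((b - a) / 2) = 1 := by field_simp; ring
    have e2 : (a - (a + b) / 2) / ((b - a) / 2) = -1 := by field_simp; ring
    simp only [e1, e2, sub_self, zero_mul, mul_zero, sqrt_zero, arcsin_one, arcsin_neg]
    ring
  · exact Continuous.continuousOn (by fun_prop)
  · intro s ⟨has, hsb⟩
    have hR : 0 < (b - s) * (s - a) := mul_pos (by linarith) (by linarith)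
    have hR' := sqrt_pos.2 hR
    refine (((((hasDerivAt_id s).sub_const ((a + b) / 2)).mul (hasDerivAt_sqrt_mul_sub has hsb)).add
      ((hasDerivAt_arcsin_affine has hsb).const_mul (((b - a) / 2) ^ 2))).div_const 2).congr_deriv ?_
    simp only [id]
    field_simp
    rw [sq_sqrt hR.le]
    ring

lemma integral_sqrt_mul_sub_div {a b : ℝ} (ha : 0 ≤ a) (hab : a < b) :
    IntegrableOn (fun s => √((b - s) * (s - a)) / s) (Icc a b) ∧
      ∫ s in Icc a b, √((b - s) * (s - a)) / s = π * ((a + b) / 2) - π * √(a * b) := by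
  have hr : b - a ≠ 0 := by linarith
  have hb : b ≠ 0 := by linarith
  have e1 : (b - (a + b) / 2) / ((b - a) / 2) = 1 := by field_simp; ring
  have e2 : (a - (a + b) / 2) / ((b - a) / 2) = -1 := by field_simp; ring
  have key := integrableOn_and_integral_eq_of_hasDerivAt_nonneg
    (f := fun x => √((b - x) * (x - a)) +
      (a + b) / 2 * arcsin ((x - (a + b) / 2) / ((b - a) / 2)) -
      √(a * b) * arcsin (((a + b) / 2 - a * b / x) / ((b - a) / 2)))
    (f' := fun s => √((b - s) * (s - a)) / s) hab.le ?_ ?_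
    (fun s hs => div_nonneg (sqrt_nonneg _) (ha.trans hs.1.le))
  · refine ⟨key.1, key.2.trans ?_⟩
    rcases ha.eq_or_lt with rfl | ha
    · simp only [e1, e2, sub_self, zero_mul, mul_zero, sqrt_zero, arcsin_one, arcsin_neg]
      ring
    · have e3 : ((a + b) / 2 - a * b / b) / ((b - a) / 2) = 1 := by field_simp; ring
      have e4 : ((a + b) / 2 - a * b / a) / ((b - a) / 2) = -1 := by field_simp; ring
      simp only [e1, e2, e3, e4, sub_self, zero_mul, mul_zero, sqrt_zero, arcsin_one, arcsin_neg]
      ring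
  · refine ContinuousOn.sub (Continuous.continuousOn (by fun_prop)) ?_
    rcases ha.eq_or_lt with rfl | ha
    · simpa using continuousOn_const
    · refine continuousOn_const.mul (continuous_arcsin.comp_continuousOn ?_)
      refine (continuousOn_const.sub (continuousOn_const.div continuousOn_id ?_)).div_const _
      exact fun x hx => (ha.trans_le hx.1).ne'
  · intro s ⟨has, hsb⟩
    have hR : 0 < (b - s) * (s - a) := mul_pos (by linarith) (by linarith)
    have hR' := sqrt_pos.2 hR
    have hs : 0 < s := by linarith
    have h12 := (hasDerivAt_sqrt_mul_sub has hsb).add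
      ((hasDerivAt_arcsin_affine has hsb).const_mul ((a + b) / 2))
    have h3 : HasDerivAt
        (fun x => √(a * b) * arcsin (((a + b) / 2 - a * b / x) / ((b - a) / 2)))
        (a * b / (s * √((b - s) * (s - a)))) s := by
      rcases ha.eq_or_lt with rfl | ha
      · simpa using hasDerivAt_const s (0 : ℝ)
      · refine ((hasDerivAt_arcsin_inv ha has hsb).const_mul (√(a * b))).congr_deriv ?_
        rw [← mul_div_assoc, mul_self_sqrt (by nlinarith)]
    refine (h12.sub h3).congr_deriv ?_
    field_simp
    rw [sq_sqrt hR.le]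
    ring

section MarchenkoPastur

variable {γ : ℝ}

lemma MP_edge_lt (hγ : 0 < γ) : (1 - √γ) ^ 2 < (1 + √γ) ^ 2 := by
  nlinarith [sqrt_pos.2 hγ]

lemma measurable_MP_density (γ : ℝ) :
    Measurable (Set.indicator (Set.Icc ((1 - Real.sqrt γ) ^ 2) ((1 + Real.sqrt γ) ^ 2))
        (fun s => ENNReal.ofReal
          (Real.sqrt (((1 + Real.sqrt γ) ^ 2 - s) * (s - (1 - Real.sqrt γ) ^ 2)) /
            (2 * Real.pi * γ * s)))) :=
  Measurable.indicator (by fun_prop) measurableSet_Icc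

lemma isProbabilityMeasure_MP (hγ : 0 < γ) : IsProbabilityMeasure (MP γ) := by
  have hq := sq_sqrt hγ.le
  obtain ⟨hint, hval⟩ := integral_sqrt_mul_sub_div (sq_nonneg (1 - √γ)) (MP_edge_lt hγ)
  have hsq : √((1 - √γ) ^ 2 * (1 + √γ) ^ 2) = |1 - γ| := by
    rw [← mul_pow, sqrt_sq_eq_abs]
    congr 1
    linear_combination -hq
  have hmid : ((1 - √γ) ^ 2 + (1 + √γ) ^ 2) / 2 = 1 + γ := by linear_combination hq
  rw [hsq, hmid] at hval
  have hfun : ∀ s : ℝ, √(((1 + √γ) ^ 2 - s) * (s - (1 - √γ) ^ 2)) / (2 * π * γ * s) =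
      (2 * π * γ)⁻¹ * (√(((1 + √γ) ^ 2 - s) * (s - (1 - √γ) ^ 2)) / s) := by
    intro s
    rw [div_mul_eq_div_div_swap, div_eq_inv_mul]
  have hπ := pi_pos
  constructor
  simp only [MP, Measure.add_apply, Measure.smul_apply, measure_univ, smul_eq_mul, mul_one,
    withDensity_apply _ MeasurableSet.univ, Measure.restrict_univ]
  rw [lintegral_indicator measurableSet_Icc]
  simp only [hfun]
  rw [← ofReal_integral_eq_lintegral_ofReal (hint.const_mul _), integral_const_mul, hval,
    ← ENNReal.ofReal_add (le_max_left _ _), ← ENNReal.ofReal_one]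
  · congr 1
    rcases le_total γ 1 with h | h
    · rw [abs_of_nonneg (by linarith), max_eq_left]
      · field_simp
        ring
      · rw [sub_nonpos, le_div_iff₀ hγ]
        linarith
    · rw [abs_of_nonpos (by linarith), max_eq_right]
      · field_simp
        ring
      · rw [sub_nonneg, div_le_iff₀ hγ]
        linarith
  · have : |1 - γ| ≤ 1 + γ := abs_le.2 ⟨by linarith, by linarith⟩
    have : 0 ≤ π * (1 + γ) - π * |1 - γ| := by nlinarith
    positivity
  · filter_upwards [ae_restrict_mem measurableSet_Icc] with s hs
    have : 0 ≤ s := (sq_nonneg _).trans hs.1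
    simp only [Pi.zero_apply]
    positivity

lemma ae_nonneg_MP (γ : ℝ) : ∀ᵐ s ∂(MP γ), 0 ≤ s := by
  rw [MP, ae_add_measure_iff]
  constructor
  · refine Measure.ae_smul_measure ?_ _
    rw [ae_dirac_iff measurableSet_Ici]
  · rw [ae_withDensity_iff (measurable_MP_density γ)]
    refine Filter.Eventually.of_forall fun s hs => ?_
    exact (sq_nonneg _).trans (mem_of_indicator_ne_zero hs).1

lemma lintegral_ofReal_MP (hγ : 0 < γ) : ∫⁻ s, ENNReal.ofReal s ∂(MP γ) = 1 := by
  have hq := sq_sqrt hγ.le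
  have hπ := pi_pos
  obtain ⟨hint, hval⟩ := integral_sqrt_mul_sub (MP_edge_lt hγ)
  rw [MP, lintegral_add_measure, lintegral_smul_measure, lintegral_dirac, ENNReal.ofReal_zero,
    smul_zero, zero_add,
    lintegral_withDensity_eq_lintegral_mul _ (measurable_MP_density γ) (by fun_prop)]
  simp only [Pi.mul_apply, ← indicator_mul_left]
  rw [lintegral_indicator measurableSet_Icc]
  have hfun : ∀ s ∈ Icc ((1 - √γ) ^ 2) ((1 + √γ) ^ 2),
      ENNReal.ofReal (√(((1 + √γ) ^ 2 - s) * (s - (1 - √γ) ^ 2)) / (2 * π * γ * s)) *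
        ENNReal.ofReal s =
      ENNReal.ofReal ((2 * π * γ)⁻¹ * √(((1 + √γ) ^ 2 - s) * (s - (1 - √γ) ^ 2))) := by
    intro s hs
    have hs0 : 0 ≤ s := (sq_nonneg _).trans hs.1
    rw [← ENNReal.ofReal_mul (by positivity)]
    congr 1
    rcases hs0.eq_or_lt with rfl | hs0
    · have : (1 - √γ) ^ 2 = 0 := le_antisymm hs.1 (sq_nonneg _)
      simp [this]
    · field_simp
  rw [setLIntegral_congr_fun measurableSet_Icc hfun,
    ← ofReal_integral_eq_lintegral_ofReal (hint.const_mul _), integral_const_mul, hval,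
    ← ENNReal.ofReal_one]
  · congr 1
    field_simp
    linear_combination 16 * hq
  · exact Filter.Eventually.of_forall fun s => by positivity

end MarchenkoPastur

/-- The bound holds for every probability measure on `[0, ∞)` with mean one, by two applications
of the Cauchy–Schwarz inequality. -/
lemma sq_one_sub_sqrt_le_integral {μ : Measure ℝ} [IsProbabilityMeasure μ]
    (hμ : ∀ᵐ s ∂μ, 0 ≤ s) (hid : Integrable (fun s => s) μ) (hmean : ∫ s, s ∂μ = 1)
    {l : ℝ} (hl : 0 < l) :
    (1 - √(l ^ 2 * ∫ s, 1 / (s + l) ^ 2 ∂μ)) ^ 2 ≤ ∫ s, s / (s + l) ^ 2 ∂μ := by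
  have hX : Integrable (fun s => l / (s + l)) μ := by
    refine Integrable.of_bound (Measurable.aestronglyMeasurable (by fun_prop)) 1 ?_
    filter_upwards [hμ] with s hs
    rw [norm_of_nonneg (by positivity), div_le_one (by positivity)]
    linarith
  have hX2 : Integrable (fun s => (l / (s + l)) ^ 2) μ := by
    refine Integrable.of_bound (Measurable.aestronglyMeasurable (by fun_prop)) 1 ?_
    filter_upwards [hμ] with s hs
    rw [norm_of_nonneg (by positivity)]
    exact pow_le_one₀ (by positivity) ((div_le_one (by positivity)).2 (by linarith))
  have hS : Integrable (fun s => s / (s + l) ^ 2) μ := by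
    refine ((hX.sub hX2).div_const l).congr ?_
    filter_upwards [hμ] with s hs
    have : 0 < s + l := by linarith
    simp only [Pi.sub_apply]
    field_simp
    ring
  have hm2 : l ^ 2 * ∫ s, 1 / (s + l) ^ 2 ∂μ = ∫ s, (l / (s + l)) ^ 2 ∂μ := by
    rw [← integral_const_mul]
    simp only [div_pow, mul_one_div]
  rw [hm2]
  set m := ∫ s, l / (s + l) ∂μ
  have hX2_le : ∫ s, (l / (s + l)) ^ 2 ∂μ ≤ 1 := by
    have : ∫ s, (l / (s + l)) ^ 2 ∂μ ≤ ∫ _, (1 : ℝ) ∂μ := by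
      refine integral_mono_ae hX2 (integrable_const 1) ?_
      filter_upwards [hμ] with s hs
      exact pow_le_one₀ (by positivity) ((div_le_one (by positivity)).2 (by linarith))
    simpa using this
  have hm_sq : m ^ 2 ≤ ∫ s, (l / (s + l)) ^ 2 ∂μ := by
    have h : ∫ s, (2 * m * (l / (s + l)) - m ^ 2) ∂μ ≤ ∫ s, (l / (s + l)) ^ 2 ∂μ :=
      integral_mono ((hX.const_mul _).sub (integrable_const _)) hX2
        fun s => by nlinarith [sq_nonneg (l / (s + l) - m)]
    rw [integral_sub (hX.const_mul _) (integrable_const _), integral_const_mul] at h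
    simp only [integral_const, probReal_univ, one_smul] at h
    change 2 * m * m - m ^ 2 ≤ _ at h
    linarith
  have hY : Integrable (fun s => 1 - l / (s + l)) μ := (integrable_const 1).sub hX
  have hQ : (1 - m) ^ 2 ≤ ∫ s, s / (s + l) ^ 2 ∂μ := by
    have h : ∫ s, (2 * (1 - m) * (1 - l / (s + l)) - (1 - m) ^ 2 * s) ∂μ ≤
        ∫ s, s / (s + l) ^ 2 ∂μ := by
      refine integral_mono_ae ((hY.const_mul _).sub (hid.const_mul _)) hS ?_
      filter_upwards [hμ] with s hs
      have hsl : 0 < s + l := by linarith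
      have : s / (s + l) ^ 2 - (2 * (1 - m) * (1 - l / (s + l)) - (1 - m) ^ 2 * s) =
          s * (1 / (s + l) - (1 - m)) ^ 2 := by
        field_simp
        ring
      have : 0 ≤ s * (1 / (s + l) - (1 - m)) ^ 2 := by positivity
      linarith
    rw [integral_sub (hY.const_mul _) (hid.const_mul _),
      integral_const_mul, integral_const_mul, integral_sub (integrable_const 1) hX, hmean] at h
    simp only [integral_const, probReal_univ, one_smul] at h
    change 2 * (1 - m) * (1 - m) - (1 - m) ^ 2 * 1 ≤ _ at h
    linarith
  have h1 : m ≤ √(∫ s, (l / (s + l)) ^ 2 ∂μ) := le_sqrt_of_sq_le hm_sq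
  have h2 : √(∫ s, (l / (s + l)) ^ 2 ∂μ) ≤ 1 := sqrt_le_one.2 hX2_le
  exact (pow_le_pow_left₀ (by linarith) (by linarith) 2).trans hQ

theorem stmt14 (γ : ℝ) (hγ : 0 < γ) (lam : ℝ) (hlam : 0 < lam) :
    (1 - Real.sqrt (lam ^ 2 * ∫ s, 1 / (s + lam) ^ 2 ∂(MP γ))) ^ 2 ≤
      ∫ s, s / (s + lam) ^ 2 ∂(MP γ) := by
  have := isProbabilityMeasure_MP hγ
  have hnn := ae_nonneg_MP γ
  have hlint := lintegral_ofReal_MP hγ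
  refine sq_one_sub_sqrt_le_integral hnn ⟨by fun_prop, ?_⟩ ?_ hlam
  · rw [hasFiniteIntegral_iff_ofReal hnn, hlint]
    exact ENNReal.one_lt_top
  · rw [integral_eq_lintegral_of_nonneg_ae hnn (by fun_prop), hlint, ENNReal.toReal_one]
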